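/- (Correctness of the list-decoder for folded Gabidulin codes.) Let n = g·h ≤ m with g, h positive integers, 1 ≤ s ≤ h, 1 ≤ k ≤ m, and let γ ∈ F_{q^m} be such that 1, γ, ..., γ^{n−1} are linearly independent over F_q and γ, γ^q, ..., γ^{q^{m−1}} are pairwise distinct. Let u ∈ F_{q^m}^k with linearized message polynomial f_u(X) = ∑_{j=0}^{k−1} u_j X^{q^j}, and let U_{i,j} = f_u(γ^{ih+j}) be the folded Gabidulin codeword. Let Y ∈ F_{q^m}^{g×h} be such that the rows of Y−U span an F_q-subspace of F_{q^m}^h of dimension at most t (the error has F_q-rank at most t). Set d = ⌈(g(h−s+1) + s(k−1) + 1)/(s+1)⌉ and assume k ≤ d. If t < (g·s/(s+1))·(1 − h(k−1)/((h−s+1)·n)), then: (i) there exist linearized polynomials Q_0, ..., Q_s over F_{q^m}, not all zero, with Q_0 of q-degree at most d−1 and each Q_l (l ≥ 1) of q-degree at most d−k, satisfying Q_0(γ^{ih+j}) + ∑_{l=1}^{s} Q_l(Y_{i,j+l−1}) = 0 for all 0 ≤ i ≤ g−1, 0 ≤ j ≤ h−s; (ii) for every such nonzero tuple, f_u satisfies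 Q_0(X) + ∑_{l=1}^{s} Q_l(f_u(γ^{l−1}X)) = 0 as a polynomial identity; and (iii) the number of linearized polynomials f of q-degree at most k−1 satisfying this identity is at most q^{m(s−1)}. -/

import Mathlib

open Polynomial

/-- The linearized polynomial `∑ i, a i * X^(q^i)` with coefficient vector `a`. -/
noncomputable def linPoly (q : ℕ) {F : Type*} [Field F] {D : ℕ} (a : Fin D → F) : Polynomial F :=
  ∑ i : Fin D, Polynomial.C (a i) * Polynomial.X ^ (q ^ (i : ℕ))


section Helpers

theorem lin_eval {q : ℕ} {F : Type*} [Field F] {D : ℕ} (a : Fin D → F) (x : F) :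
    (linPoly q a).eval x = ∑ i : Fin D, a i * x ^ (q ^ (i : ℕ)) := by
  simp [linPoly, eval_finsetSum]

theorem lin_coeff {q : ℕ} (hq : 2 ≤ q) {F : Type*} [Field F] {D : ℕ} (a : Fin D → F) (r : Fin D) :
    (linPoly q a).coeff (q ^ (r : ℕ)) = a r := by
  simp only [linPoly, finsetSum_coeff, coeff_C_mul, coeff_X_pow]
  rw [Finset.sum_eq_single r]
  · simp
  · intro i _ hi
    rw [if_neg]
    · simp
    · intro h
      exact hi (Fin.ext (Nat.pow_right_injective hq h).symm)
  · simp

theorem lin_eq_zero {q : ℕ} (hq : 2 ≤ q) {F : Type*} [Field F] {D : ℕ} (a : Fin D → F)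
    (h : linPoly q a = 0) : a = 0 := by
  funext r
  rw [← lin_coeff hq a r, h]; simp

theorem lin_natDegree {q : ℕ} (hq : 2 ≤ q) {F : Type*} [Field F] {D : ℕ} (a : Fin D → F) :
    (linPoly q a).natDegree ≤ q ^ (D - 1) := by
  unfold linPoly
  apply natDegree_sum_le_of_forall_le
  intro i _
  refine (natDegree_C_mul_X_pow_le _ _).trans (Nat.pow_le_pow_right (by omega) (by omega))

theorem frob_iter (K R : Type*) [Field K] [CommRing R] [Algebra K R] [Fintype K] (i : ℕ) (x : R) :
    ((FiniteField.frobeniusAlgHom K R) ^ i) x = x ^ Fintype.card K ^ i := by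
  induction i with
  | zero => simp
  | succ i ih =>
    rw [pow_succ', AlgHom.mul_apply, ih, FiniteField.frobeniusAlgHom_apply, ← pow_mul, ← pow_succ]

theorem q_sum_pow {K F : Type*} [Field K] [Field F] [Algebra K F] [Fintype K]
    {q : ℕ} (hK : Fintype.card K = q) {ι : Type*} (S : Finset ι) (f : ι → F[X]) (i : ℕ) :
    (∑ x ∈ S, f x) ^ q ^ i = ∑ x ∈ S, f x ^ q ^ i := by
  subst hK
  simp only [← frob_iter K, map_sum]

theorem sum_comp_aux {F : Type*} [Field F] {ι : Type*} (S : Finset ι) (f : ι → F[X]) (p : F[X]) :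
    (∑ x ∈ S, f x).comp p = ∑ x ∈ S, (f x).comp p :=
  map_sum (compRingHom p) f S

theorem comp_expand {K F : Type*} [Field K] [Field F] [Algebra K F] [Fintype K]
    {q : ℕ} (hK : Fintype.card K = q) {D k : ℕ} (b : Fin D → F) (a : Fin k → F) (c : F) :
    (linPoly q b).comp ((linPoly q a).comp (C c * X)) =
      ∑ i : Fin D, ∑ j : Fin k,
        C (b i * a j ^ q ^ (i : ℕ) * c ^ q ^ ((i : ℕ) + j)) * X ^ q ^ ((i : ℕ) + j) := by
  have h1 : (linPoly q a).comp (C c * X) = ∑ j : Fin k, C (a j * c ^ q ^ (j : ℕ)) * X ^ q ^ (j : ℕ) := by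
    simp [linPoly, sum_comp_aux, mul_pow, mul_assoc]
  rw [h1]
  unfold linPoly
  rw [sum_comp_aux]
  refine Finset.sum_congr rfl fun i _ => ?_
  simp only [mul_comp, C_comp, pow_comp, X_comp]
  rw [q_sum_pow hK, Finset.mul_sum]
  refine Finset.sum_congr rfl fun j _ => ?_
  rw [mul_pow, ← C_pow, ← mul_assoc, ← C_mul, ← pow_mul, mul_pow, ← pow_mul, ← pow_add,
    add_comm (j : ℕ), mul_assoc]

/-- coefficient vector of `Q_0 + ∑ Q_l(f_a(γ^l X))`. -/
noncomputable def cvec (q : ℕ) {F : Type*} [Field F] {d s D k : ℕ} (γ : F) (b0 : Fin d → F)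
    (b : Fin s → Fin D → F) (a : Fin k → F) (r : Fin d) : F :=
  b0 r + ∑ l : Fin s, ∑ i : Fin D, ∑ j : Fin k,
    if (i : ℕ) + j = r then b l i * a j ^ q ^ (i : ℕ) * (γ ^ (l : ℕ)) ^ q ^ (r : ℕ) else 0

theorem cvec_spec {K F : Type*} [Field K] [Field F] [Algebra K F] [Fintype K]
    {q : ℕ} (hK : Fintype.card K = q) {d s k : ℕ} (hk : 1 ≤ k) (hkd : k ≤ d)
    (γ : F) (b0 : Fin d → F) (b : Fin s → Fin (d - k + 1) → F) (a : Fin k → F) :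
    linPoly q b0 + ∑ l : Fin s, (linPoly q (b l)).comp ((linPoly q a).comp (C (γ ^ (l : ℕ)) * X))
      = linPoly q (cvec q γ b0 b a) := by
  simp only [comp_expand hK]
  unfold linPoly cvec
  simp only [map_add, add_mul, Finset.sum_add_distrib]
  congr 1
  simp only [map_sum, Finset.sum_mul]
  symm
  rw [Finset.sum_comm]
  refine Finset.sum_congr rfl fun l _ => ?_
  rw [Finset.sum_comm]
  refine Finset.sum_congr rfl fun i _ => ?_
  rw [Finset.sum_comm]
  refine Finset.sum_congr rfl fun j _ => ?_
  rw [Finset.sum_eq_single (⟨(i : ℕ) + j, by omega⟩ : Fin d)]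
  · simp
  · intro r _ hr
    rw [if_neg]
    · simp
    · intro h; exact hr (Fin.ext h.symm)
  · simp

/-- evaluation of a linearized polynomial as a `K`-linear map -/
noncomputable def linMap (K : Type*) {F : Type*} [Field K] [Field F] [Algebra K F] [Fintype K]
    {D : ℕ} (a : Fin D → F) : F →ₗ[K] F :=
  ∑ i : Fin D, (LinearMap.mulLeft K (a i)) ∘ₗ ((FiniteField.frobeniusAlgHom K F) ^ (i : ℕ)).toLinearMap

theorem linMap_apply {K F : Type*} [Field K] [Field F] [Algebra K F] [Fintype K]
    {q : ℕ} (hK : Fintype.card K = q) {D : ℕ} (a : Fin D → F) (x : F) :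
    linMap K a x = (linPoly q a).eval x := by
  subst hK
  rw [lin_eval, linMap]
  simp only [LinearMap.sum_apply, LinearMap.comp_apply, LinearMap.mulLeft_apply,
    AlgHom.toLinearMap_apply]
  refine Finset.sum_congr rfl fun i _ => ?_
  rw [frob_iter]

theorem lin_zero_of_ker {K F : Type*} [Field K] [Field F] [Algebra K F] [Fintype K] [Fintype F]
    {q : ℕ} (hq : 2 ≤ q) (hK : Fintype.card K = q) {D : ℕ} (hD : 1 ≤ D) (a : Fin D → F)
    (h : D ≤ Module.finrank K (LinearMap.ker (linMap K a))) : linPoly q a = 0 := by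
  classical
  by_contra hne
  have h1 : Nat.card (LinearMap.ker (linMap K a)) = q ^ Module.finrank K (LinearMap.ker (linMap K a)) := by
    rw [Module.natCard_eq_pow_finrank (K := K), Nat.card_eq_fintype_card, hK]
  have h2 : Nat.card (LinearMap.ker (linMap K a)) ≤ (linPoly q a).roots.toFinset.card := by
    rw [Nat.card_eq_fintype_card, ← Fintype.card_coe]
    refine Fintype.card_le_of_injective
      (fun x => (⟨x.1, ?_⟩ : {y // y ∈ (linPoly q a).roots.toFinset})) ?_
    · have := x.2
      rw [LinearMap.mem_ker, linMap_apply hK] at this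
      simp [hne, this]
    · intro x y hxy
      exact Subtype.ext (by simpa using hxy)
  have h3 := (linPoly q a).roots.toFinset_card_le
  have h4 := (linPoly q a).card_roots'
  have h5 := lin_natDegree hq a
  have h6 : q ^ D ≤ q ^ Module.finrank K (LinearMap.ker (linMap K a)) :=
    Nat.pow_le_pow_right (by omega) h
  have h7 : q ^ (D - 1) < q ^ D := Nat.pow_lt_pow_right (by omega) (by omega)
  omega

theorem part_one {F : Type*} [Field F] (q : ℕ) {d s D : ℕ} (g w : ℕ)
    (hN : g * w < d + s * D) (A : Fin g × Fin w → F) (Z : Fin g × Fin w → Fin s → F) :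
    ∃ (b0 : Fin d → F) (b : Fin s → Fin D → F), ¬(b0 = 0 ∧ b = 0) ∧
      ∀ x, (linPoly q b0).eval (A x) + ∑ l, (linPoly q (b l)).eval (Z x l) = 0 := by
  let L : ((Fin d → F) × (Fin s → Fin D → F)) →ₗ[F] (Fin g × Fin w → F) :=
    { toFun := fun b x => (linPoly q b.1).eval (A x) + ∑ l, (linPoly q (b.2 l)).eval (Z x l)
      map_add' := by
        intro b b'; funext x
        simp only [lin_eval, Prod.fst_add, Prod.snd_add, Pi.add_apply, add_mul, Finset.sum_add_distrib]
        ring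
      map_smul' := by
        intro c b; funext x
        simp only [lin_eval, Prod.smul_fst, Prod.smul_snd, Pi.smul_apply, smul_eq_mul, mul_assoc,
          RingHom.id_apply, mul_add, Finset.mul_sum] }
  have hL : LinearMap.ker L ≠ ⊥ := by
    apply LinearMap.ker_ne_bot_of_finrank_lt
    simp [Module.finrank_pi_fintype, hN]
  obtain ⟨⟨b0, b⟩, hmem, hne⟩ := (Submodule.ne_bot_iff _).mp hL
  refine ⟨b0, b, fun h => hne (by rw [h.1, h.2]; rfl), fun x => ?_⟩
  exact congrFun (LinearMap.mem_ker.1 hmem) x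

theorem part_two_dim {K F : Type*} [Field K] [Field F] [Algebra K F] [Fintype K] [Fintype F]
    {g h w t : ℕ} (hw : w ≤ h) (γ : F) (hγ : LinearIndependent K fun i : Fin (g * h) => γ ^ (i : ℕ))
    (e : Fin g → Fin h → F)
    (hr : Module.finrank K (Submodule.span K (Set.range e)) ≤ t)
    (V : Submodule K F)
    (hV : ∀ c : Fin g → K, ∑ i, c i • e i = 0 → ∀ j < w, ∑ i, c i • γ ^ ((i : ℕ) * h + j) ∈ V) :
    (g - t) * w ≤ Module.finrank K V := by
  let T : (Fin g → K) →ₗ[K] (Fin h → F) := Fintype.linearCombination K e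
  have hT : Module.finrank K (LinearMap.range T) ≤ t := by
    rw [Fintype.range_linearCombination]; exact hr
  have hrn := T.finrank_range_add_finrank_ker
  rw [Module.finrank_fin_fun] at hrn
  let v : Fin g × Fin w → F := fun x => γ ^ ((x.1 : ℕ) * h + x.2)
  have hlt : ∀ x : Fin g × Fin w, (x.1 : ℕ) * h + x.2 < g * h := by
    rintro ⟨i, j⟩
    have : ((i : ℕ) + 1) * h ≤ g * h := Nat.mul_le_mul_right h i.2
    simp only
    nlinarith [j.2]
  have hv : LinearIndependent K v := by
    have := hγ.comp (fun x : Fin g × Fin w => (⟨(x.1 : ℕ) * h + x.2, hlt x⟩ : Fin (g * h))) (by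
      rintro ⟨i, j⟩ ⟨i', j'⟩ hx
      simp only [Fin.mk.injEq] at hx
      have hj : (j : ℕ) < h := lt_of_lt_of_le j.2 hw
      have hj' : (j' : ℕ) < h := lt_of_lt_of_le j'.2 hw
      have h1 := congrArg (· % h) hx
      simp only [Nat.mul_add_mod', Nat.mod_eq_of_lt hj, Nat.mod_eq_of_lt hj'] at h1
      have h2 : (i : ℕ) * h = i' * h := by omega
      have h3 := Nat.eq_of_mul_eq_mul_right (by omega) h2
      ext <;> simp [h1, h3])
    exact this
  let Ψ : (Fin w → LinearMap.ker T) →ₗ[K] F :=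
    ∑ j : Fin w, ∑ i : Fin g,
      (LinearMap.toSpanSingleton K F (v (i, j))) ∘ₗ (LinearMap.proj i) ∘ₗ (LinearMap.ker T).subtype ∘ₗ
        (LinearMap.proj j)
  have hΨ : ∀ x, Ψ x = ∑ j : Fin w, ∑ i : Fin g, (x j : Fin g → K) i • v (i, j) := by
    intro x; simp [Ψ, LinearMap.sum_apply]
  have hinj : Function.Injective Ψ := by
    rw [← LinearMap.ker_eq_bot, LinearMap.ker_eq_bot']
    intro x hx
    rw [hΨ] at hx
    rw [Fintype.linearIndependent_iff] at hv
    have := hv (fun y => (x y.2 : Fin g → K) y.1) (by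
      rw [Fintype.sum_prod_type, Finset.sum_comm]; exact hx)
    funext j
    ext i
    exact this (i, j)
  have hmem : ∀ x, Ψ x ∈ V := by
    intro x
    rw [hΨ]
    refine Submodule.sum_mem _ fun j _ => ?_
    refine hV _ ?_ j j.2
    have := (x j).2
    rw [LinearMap.mem_ker] at this
    exact this
  have hle := LinearMap.finrank_le_finrank_of_injective (f := Ψ.codRestrict V hmem)
    (fun a b hab => hinj (congrArg Subtype.val hab))
  rw [Module.finrank_pi_fintype] at hle
  simp only [Finset.sum_const, Finset.card_univ, Fintype.card_fin, smul_eq_mul] at hle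
  have : g - t ≤ Module.finrank K (LinearMap.ker T) := by omega
  calc (g - t) * w ≤ Module.finrank K (LinearMap.ker T) * w := Nat.mul_le_mul_right _ this
    _ ≤ _ := by rw [mul_comm]; exact hle

theorem part_three {K F : Type*} [Field K] [Field F] [Algebra K F] [Fintype K] [Fintype F]
    {q m : ℕ} (hq : 2 ≤ q) (hK : Fintype.card K = q) (hF : Fintype.card F = q ^ m)
    {d s k : ℕ} (hs : 1 ≤ s) (hk : 1 ≤ k) (hkd : k ≤ d) (hdm : d ≤ m)
    (γ : F) (hγdis : ∀ i < m, ∀ j < m, i ≠ j → γ ^ q ^ i ≠ γ ^ q ^ j)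
    (b0 : Fin d → F) (b : Fin s → Fin (d - k + 1) → F) (hb : ¬ (b0 = 0 ∧ b = 0)) :
    Set.ncard {a : Fin k → F | cvec q γ b0 b a = 0} ≤ q ^ (m * (s - 1)) := by
  classical
  by_cases hb' : b = 0
  · have : {a : Fin k → F | cvec q γ b0 b a = 0} = ∅ := by
      ext a
      simp only [Set.mem_ofPred_eq, Set.mem_empty_iff_false, iff_false]
      intro ha
      apply hb
      refine ⟨?_, hb'⟩
      funext r
      have := congrFun ha r
      simpa [cvec, hb'] using this
    rw [this]; simp
  have hex : ∃ i : ℕ, ∃ hi : i < d - k + 1, ∃ l, b l ⟨i, hi⟩ ≠ 0 := by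
    by_contra hcon
    push Not at hcon
    apply hb'
    funext l i
    exact hcon i i.2 l
  obtain ⟨i0, ⟨hi0, l0, hl0⟩, hmin⟩ : ∃ i0 : ℕ, (∃ hi : i0 < d - k + 1, ∃ l, b l ⟨i0, hi⟩ ≠ 0) ∧
      ∀ i : Fin (d - k + 1), (i : ℕ) < i0 → ∀ l, b l i = 0 := by
    refine ⟨Nat.find hex, Nat.find_spec hex, ?_⟩
    intro i hi l
    have := Nat.find_min hex hi
    push Not at this
    exact this i.2 l
  let B : F[X] := ∑ l : Fin s, C (b l ⟨i0, hi0⟩) * X ^ (l : ℕ)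
  have hBne : B ≠ 0 := by
    intro h0
    apply hl0
    have : B.coeff l0 = 0 := by rw [h0]; simp
    simpa [B, finsetSum_coeff, coeff_X_pow, Fin.val_inj] using this
  have hBdeg : B.natDegree ≤ s - 1 := by
    apply natDegree_sum_le_of_forall_le
    intro i _
    refine (natDegree_C_mul_X_pow_le _ _).trans (by omega)
  let Bad : Finset (Fin k) := Finset.univ.filter fun j => B.eval (γ ^ q ^ (i0 + j)) = 0
  have hBad : Bad.card ≤ s - 1 := by
    have h1 : Bad.card ≤ B.roots.toFinset.card := by
      apply Finset.card_le_card_of_injOn (fun j : Fin k => γ ^ q ^ (i0 + (j : ℕ)))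
      · intro j hj
        have : B.eval (γ ^ q ^ (i0 + (j : ℕ))) = 0 := by simpa [Bad] using hj
        simp [hBne, this]
      · intro j _ j' _ hjj
        by_contra hne
        refine hγdis (i0 + j) (by omega) (i0 + j') (by omega) ?_ hjj
        intro h; apply hne; ext; omega
    exact (h1.trans (Multiset.toFinset_card_le _)).trans ((card_roots' _).trans hBdeg)
  have hkey : ∀ a a' : Fin k → F, cvec q γ b0 b a = 0 → cvec q γ b0 b a' = 0 →
      (∀ j ∈ Bad, a j = a' j) → ∀ N : ℕ, ∀ hN : N < k, a ⟨N, hN⟩ = a' ⟨N, hN⟩ := by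
    intro a a' ha ha' hbad N
    induction N using Nat.strong_induction_on with
    | _ N ih =>
      intro hN
      by_cases hmem : (⟨N, hN⟩ : Fin k) ∈ Bad
      · exact hbad _ hmem
      have hev : B.eval (γ ^ q ^ (i0 + N)) ≠ 0 := by simpa [Bad] using hmem
      have hr : i0 + N < d := by omega
      have e1 := congrFun ha ⟨i0 + N, hr⟩
      have e2 := congrFun ha' ⟨i0 + N, hr⟩
      have e3 : cvec q γ b0 b a ⟨i0 + N, hr⟩ - cvec q γ b0 b a' ⟨i0 + N, hr⟩ =
          B.eval (γ ^ q ^ (i0 + N)) *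
            (a ⟨N, hN⟩ ^ q ^ i0 - a' ⟨N, hN⟩ ^ q ^ i0) := by
        simp only [cvec, add_sub_add_left_eq_sub, ← Finset.sum_sub_distrib, B, eval_finsetSum,
          Finset.sum_mul, eval_mul, eval_C, eval_pow, eval_X]
        refine Finset.sum_congr rfl fun l _ => ?_
        rw [Finset.sum_eq_single ⟨i0, hi0⟩]
        · rw [Finset.sum_eq_single ⟨N, hN⟩]
          · simp only [if_true, ← pow_mul, mul_comm (l : ℕ)]
            ring
          · intro j _ hj
            rw [if_neg, if_neg, sub_zero]
            all_goals
              intro h; apply hj; ext; simp only at h ⊢; omega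
          · simp
        · intro i _ hi
          refine Finset.sum_eq_zero fun j _ => ?_
          have hi' : (i : ℕ) ≠ i0 := fun h => hi (Fin.ext h)
          rcases lt_or_gt_of_ne hi' with hlt | hgt
          · simp [hmin i hlt l]
          · split_ifs with hij
            · have := ih j (by omega) j.2
              rw [show a j = a' j from this, sub_self]
            · simp
        · simp
      rw [e1, e2] at e3
      have e4 : a ⟨N, hN⟩ ^ q ^ i0 - a' ⟨N, hN⟩ ^ q ^ i0 = 0 := by
        rcases mul_eq_zero.1 (by simpa using e3.symm : B.eval (γ ^ q ^ (i0 + N)) *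
            (a ⟨N, hN⟩ ^ q ^ i0 - a' ⟨N, hN⟩ ^ q ^ i0) = 0) with h | h
        · exact absurd h hev
        · exact h
      have e5 := frob_iter K F i0
      rw [hK] at e5
      refine RingHom.injective ((FiniteField.frobeniusAlgHom K F) ^ i0).toRingHom ?_
      change ((FiniteField.frobeniusAlgHom K F) ^ i0) _ = ((FiniteField.frobeniusAlgHom K F) ^ i0) _
      rw [e5, e5]
      exact sub_eq_zero.1 e4
  have hinj : Set.InjOn (fun (a : Fin k → F) (j : Bad) => a j) {a : Fin k → F | cvec q γ b0 b a = 0} := by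
    intro a ha a' ha' haa
    funext j
    exact hkey a a' ha ha' (fun j hj => congrFun haa ⟨j, hj⟩) j j.2
  rw [← hinj.ncard_image]
  refine (Set.ncard_le_ncard (Set.subset_univ _)).trans ?_
  rw [Set.ncard_univ, Nat.card_eq_fintype_card, Fintype.card_fun, hF, Fintype.card_coe, ← pow_mul]
  exact Nat.pow_le_pow_right (by omega) (Nat.mul_le_mul_left _ hBad)

end Helpers

/-- Correctness of the list-decoder for folded Gabidulin codes: if the error `Y - U` has
`F_q`-rank at most `t`, `d = ⌈(g(h-s+1) + s(k-1) + 1)/(s+1)⌉ ≥ k`, and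
`t < (gs/(s+1))·(1 - h(k-1)/((h-s+1)n))`, then (i) a nonzero interpolation tuple
`(Q_0, …, Q_s)` with the prescribed degree bounds satisfying the interpolation conditions
exists, (ii) every such tuple satisfies `Q_0(X) + ∑ Q_l(f_u(γ^{l-1} X)) = 0`, and (iii) the
number of linearized polynomials `f` of `q`-degree at most `k-1` satisfying this identity is
at most `q^{m(s-1)}`. -/
theorem stmt12 (q m n g h s k t d : ℕ) (hq : IsPrimePow q)
    (hg : 1 ≤ g) (hh : 1 ≤ h) (hn : n = g * h) (hnm : n ≤ m)
    (hs : 1 ≤ s) (hsh : s ≤ h) (hk1 : 1 ≤ k) (hkm : k ≤ m)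
    {K F : Type*} [Field K] [Field F] [Algebra K F] [Fintype K] [Fintype F]
    (hK : Fintype.card K = q) (hF : Fintype.card F = q ^ m)
    (γ : F) (hγind : LinearIndependent K fun i : Fin n => γ ^ (i : ℕ))
    (hγdis : ∀ i < m, ∀ j < m, i ≠ j → γ ^ q ^ i ≠ γ ^ q ^ j)
    (u : Fin k → F)
    (Y : ℕ → ℕ → F)
    (hrank : Module.finrank K
      ↥(Submodule.span K (Set.range fun i : Fin g =>
          fun j : Fin h => Y (i : ℕ) (j : ℕ) - (linPoly q u).eval (γ ^ ((i : ℕ) * h + (j : ℕ)))))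
      ≤ t)
    (hd : d = (g * (h - s + 1) + s * (k - 1) + 1 + s) / (s + 1)) (hkd : k ≤ d)
    (ht : (t : ℝ) < ((g : ℝ) * s / (s + 1)) *
      (1 - (h : ℝ) * ((k : ℝ) - 1) / (((h : ℝ) - (s : ℝ) + 1) * (n : ℝ)))) :
    (∃ (b0 : Fin d → F) (b : Fin s → Fin (d - k + 1) → F),
      ¬(b0 = 0 ∧ b = 0) ∧
      ∀ i < g, ∀ j, j + s ≤ h →
        (linPoly q b0).eval (γ ^ (i * h + j)) +
          ∑ l : Fin s, (linPoly q (b l)).eval (Y i (j + (l : ℕ))) = 0) ∧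
    (∀ (b0 : Fin d → F) (b : Fin s → Fin (d - k + 1) → F),
      ¬(b0 = 0 ∧ b = 0) →
      (∀ i < g, ∀ j, j + s ≤ h →
        (linPoly q b0).eval (γ ^ (i * h + j)) +
          ∑ l : Fin s, (linPoly q (b l)).eval (Y i (j + (l : ℕ))) = 0) →
      linPoly q b0 +
        ∑ l : Fin s, (linPoly q (b l)).comp ((linPoly q u).comp (C (γ ^ (l : ℕ)) * X)) = 0) ∧
    (∀ (b0 : Fin d → F) (b : Fin s → Fin (d - k + 1) → F),
      ¬(b0 = 0 ∧ b = 0) →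
      (∀ i < g, ∀ j, j + s ≤ h →
        (linPoly q b0).eval (γ ^ (i * h + j)) +
          ∑ l : Fin s, (linPoly q (b l)).eval (Y i (j + (l : ℕ))) = 0) →
      Set.ncard {a : Fin k → F |
        linPoly q b0 +
          ∑ l : Fin s, (linPoly q (b l)).comp ((linPoly q a).comp (C (γ ^ (l : ℕ)) * X)) = 0}
        ≤ q ^ (m * (s - 1))) := by
  have hq2 : 2 ≤ q := hq.two_le
  have hw : h - s + 1 ≤ h := by omega
  -- arithmetic
  have hnum : t < g ∧ d ≤ (g - t) * (h - s + 1) := by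
    obtain ⟨k', rfl⟩ : ∃ k', k = k' + 1 := ⟨k - 1, by omega⟩
    obtain ⟨w, hwdef⟩ : ∃ w, w = h - s + 1 := ⟨_, rfl⟩
    have hwR : (h : ℝ) - s + 1 = w := by
      rw [hwdef]; push_cast [Nat.cast_sub hsh]; ring
    have hw1 : 1 ≤ w := by omega
    have hwpos : (0 : ℝ) < w := by exact_mod_cast hw1
    have hgpos : (0 : ℝ) < g := by exact_mod_cast hg
    have hhpos : (0 : ℝ) < h := by exact_mod_cast hh
    have hspos : (0 : ℝ) < (s : ℝ) + 1 := by positivity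
    rw [hwR, hn] at ht
    push_cast at ht
    have e : (g : ℝ) * s / (s + 1) * (1 - h * ((k' : ℝ) + 1 - 1) / (w * (g * h)))
        = (g * s * w - s * k') / ((s + 1) * w) := by
      field_simp
      ring
    rw [e, lt_div_iff₀ (by positivity)] at ht
    have ht' : t * ((s + 1) * w) + s * k' < g * s * w := by
      have : (t : ℝ) * ((s + 1) * w) + s * k' < g * s * w := by linarith
      exact_mod_cast this
    have htg : t < g := by
      by_contra hcon
      push Not at hcon
      have : g * (s * w) ≤ t * ((s + 1) * w) := Nat.mul_le_mul hcon (by nlinarith)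
      nlinarith
    refine ⟨htg, ?_⟩
    rw [hd, ← hwdef]
    obtain ⟨x, rfl⟩ : ∃ x, g = t + x := ⟨g - t, by omega⟩
    rw [Nat.add_sub_cancel_left, Nat.add_sub_cancel, ← Nat.lt_succ_iff, Nat.div_lt_iff_lt_mul (by omega)]
    nlinarith
  obtain ⟨htg, hdle⟩ := hnum
  have hdm : d ≤ m := by
    calc d ≤ (g - t) * (h - s + 1) := hdle
      _ ≤ g * h := Nat.mul_le_mul (by omega) hw
      _ ≤ m := hn ▸ hnm
  refine ⟨?_, ?_, ?_⟩
  · have hN : g * (h - s + 1) < d + s * (d - k + 1) := by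
      have h1 : (g * (h - s + 1) + s * (k - 1) + 1 + s) < (d + 1) * (s + 1) := by
        rw [← Nat.div_lt_iff_lt_mul (by omega), ← hd]; omega
      obtain ⟨x, rfl⟩ : ∃ x, d = x + k := ⟨d - k, by omega⟩
      obtain ⟨k', rfl⟩ : ∃ k', k = k' + 1 := ⟨k - 1, by omega⟩
      simp only [Nat.add_sub_cancel] at h1 ⊢
      nlinarith
    obtain ⟨b0, b, hne, hb⟩ := part_one (F := F) q g (h - s + 1) hN
      (fun x => γ ^ ((x.1 : ℕ) * h + x.2)) (fun x l => Y x.1 ((x.2 : ℕ) + l))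
    exact ⟨b0, b, hne, fun i hi j hj => hb (⟨i, hi⟩, ⟨j, by omega⟩)⟩
  · intro b0 b hne hb
    rw [cvec_spec hK hk1 hkd]
    apply lin_zero_of_ker hq2 hK (by omega)
    refine hdle.trans ?_
    subst hn
    refine part_two_dim hw γ hγind _ hrank _ ?_
    intro c hc j hj
    rw [LinearMap.mem_ker, map_sum]
    have hev : ∀ i : Fin g, linMap K (cvec q γ b0 b u) (γ ^ ((i : ℕ) * h + j)) =
        - ∑ l : Fin s, linMap K (b l) (Y i (j + l) - (linPoly q u).eval (γ ^ ((i : ℕ) * h + (j + l)))) := by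
      intro i
      rw [linMap_apply hK, ← cvec_spec hK hk1 hkd]
      simp only [map_sub, Finset.sum_sub_distrib]
      simp only [linMap_apply hK, eval_add, eval_finsetSum,
        eval_comp, eval_mul, eval_C, eval_X]
      have := hb i i.2 j (by omega)
      have h2 : ∀ l : Fin s, γ ^ (l : ℕ) * γ ^ ((i : ℕ) * h + j) = γ ^ ((i : ℕ) * h + (j + l)) := by
        intro l; rw [← pow_add]; congr 1; omega
      simp only [h2]
      linear_combination this
    simp only [map_smul, hev, smul_neg, Finset.sum_neg_distrib, Finset.smul_sum]
    rw [Finset.sum_comm, neg_eq_zero]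
    refine Finset.sum_eq_zero fun l _ => ?_
    simp only [← map_smul, ← map_sum]
    have := congrFun hc ⟨j + l, by omega⟩
    simp only [Finset.sum_apply, Pi.smul_apply, Pi.zero_apply] at this
    rw [this, map_zero]
  · intro b0 b hne hb
    have := part_three hq2 hK hF hs hk1 hkd hdm γ hγdis b0 b hne
    refine le_trans (le_of_eq ?_) this
    congr 1
    ext a
    simp only [Set.mem_ofPred_eq]
    rw [cvec_spec hK hk1 hkd]
    refine ⟨lin_eq_zero hq2 _, fun h => ?_⟩
    rw [h]; simp [linPoly]
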